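/- arXiv:2208.00869 — 2 statements merged into one kernel-verified Lean document; each statement's English description precedes it below -/
import Mathlib

section
/- Let φ : R → S be a faithfully flat homomorphism of commutative rings. If M is an R-module such that M ⊗_R S is an f-projective S-module, then M is an f-projective R-module. -/
open TensorProduct CategoryTheory

universe u

noncomputable section

/-- A module `M` over a commutative ring `A` is *Mittag-Leffler relative to a class `𝒬`*
of `A`-modules if for every family `(Nᵢ)` of modules from `𝒬` the canonical map
`M ⊗[A] ∏ᵢ Nᵢ → ∏ᵢ (M ⊗[A] Nᵢ)` is injective. -/
def IsRelMittagLeffler (A : Type u) [CommRing A] (M : Type u) [AddCommGroup M] [Module A M]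
    (𝒬 : (N : Type u) → [AddCommGroup N] → [Module A N] → Prop) : Prop :=
  ∀ (I : Type u) (N : I → Type u) [∀ i, AddCommGroup (N i)] [∀ i, Module A (N i)],
    (∀ i, 𝒬 (N i)) → Function.Injective (TensorProduct.piRightHom A A M N)

/-- Given a ring map `R → S` (encoded as an `Algebra R S`) and a class `𝒬` of `R`-modules,
`BaseChangeClass R S 𝒬` is the class of `S`-modules of the form `Q ⊗[R] S` (`= S ⊗[R] Q`)
with `Q ∈ 𝒬`. -/
def BaseChangeClass (R S : Type u) [CommRing R] [CommRing S] [Algebra R S]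
    (𝒬 : (N : Type u) → [AddCommGroup N] → [Module R N] → Prop) :
    (N : Type u) → [AddCommGroup N] → [Module S N] → Prop :=
  fun N' _ _ => ∃ (Q : Type u) (_ : AddCommGroup Q) (_ : Module R Q),
    𝒬 Q ∧ Nonempty (N' ≃ₗ[S] S ⊗[R] Q)

/-- An `A`-linear map is a pure monomorphism if it stays injective after tensoring with any
`A`-module. -/
def IsPureMono {A : Type u} [CommRing A] {M N : Type u} [AddCommGroup M] [Module A M]
    [AddCommGroup N] [Module A N] (f : M →ₗ[A] N) : Prop :=
  ∀ (P : Type u) [AddCommGroup P] [Module A P], Function.Injective (LinearMap.rTensor P f)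

/-- A class of `A`-modules is definable if it is closed under isomorphisms, direct products,
direct limits and pure submodules. -/
structure IsDefinableClass (A : Type u) [CommRing A]
    (𝒞 : (N : Type u) → [AddCommGroup N] → [Module A N] → Prop) : Prop where
  closed_iso : ∀ (N₁ : Type u) [AddCommGroup N₁] [Module A N₁]
    (N₂ : Type u) [AddCommGroup N₂] [Module A N₂],
    Nonempty (N₁ ≃ₗ[A] N₂) → 𝒞 N₁ → 𝒞 N₂
  closed_prod : ∀ (I : Type u) (N : I → Type u) [∀ i, AddCommGroup (N i)]
    [∀ i, Module A (N i)], (∀ i, 𝒞 (N i)) → 𝒞 (∀ i, N i)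
  closed_directLimit : ∀ (ι : Type u) [Preorder ι] [IsDirected ι (· ≤ ·)] [DecidableEq ι]
    (G : ι → Type u) [∀ i, AddCommGroup (G i)] [∀ i, Module A (G i)]
    (f : ∀ i j, i ≤ j → G i →ₗ[A] G j), DirectedSystem G (fun i j h => f i j h) →
    (∀ i, 𝒞 (G i)) → 𝒞 (Module.DirectLimit G f)
  closed_pureSubmodule : ∀ (N : Type u) [AddCommGroup N] [Module A N] (p : Submodule A N),
    IsPureMono p.subtype → 𝒞 N → 𝒞 p

/-- The definable closure `Def(𝒬)` of a class of `A`-modules: the least definable class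
containing `𝒬`. -/
def DefClosure (A : Type u) [CommRing A]
    (𝒬 : (N : Type u) → [AddCommGroup N] → [Module A N] → Prop) :
    (N : Type u) → [AddCommGroup N] → [Module A N] → Prop :=
  fun N _ _ => ∀ (𝒞 : (N : Type u) → [AddCommGroup N] → [Module A N] → Prop),
    IsDefinableClass A 𝒞 →
    (∀ (Q : Type u) [AddCommGroup Q] [Module A Q], 𝒬 Q → 𝒞 Q) → 𝒞 N

/-- `Tor₁^A(N, M) = 0`. -/
def Tor1Vanishes (A : Type u) [CommRing A] (N M : Type u) [AddCommGroup N] [Module A N]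
    [AddCommGroup M] [Module A M] : Prop :=
  Subsingleton (((Tor (ModuleCat.{u} A) 1).obj (ModuleCat.of A N)).obj (ModuleCat.of A M))

/-- The class `𝒞^⊺` of all `A`-modules `D` with `Tor₁^A(C, D) = 0` for all `C ∈ 𝒞`. -/
def TorPerp (A : Type u) [CommRing A]
    (𝒞 : (N : Type u) → [AddCommGroup N] → [Module A N] → Prop) :
    (N : Type u) → [AddCommGroup N] → [Module A N] → Prop :=
  fun D _ _ => ∀ (C : Type u) [AddCommGroup C] [Module A C], 𝒞 C → Tor1Vanishes A C D

/-- `Ext¹_A(M, B) = 0`. -/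
def Ext1Vanishes (A : Type u) [CommRing A] (M B : Type u) [AddCommGroup M] [Module A M]
    [AddCommGroup B] [Module A B] : Prop :=
  Subsingleton
    (((Ext A (ModuleCat.{u} A) 1).obj (Opposite.op (ModuleCat.of A M))).obj (ModuleCat.of A B))

/-- The dual definable class `𝒬^∨`: the least definable class containing the character modules
`Q⁺ = Hom_ℤ(Q, ℚ/ℤ)` of all `Q ∈ 𝒬`. -/
def DualDefClass (A : Type u) [CommRing A]
    (𝒬 : (N : Type u) → [AddCommGroup N] → [Module A N] → Prop) :
    (N : Type u) → [AddCommGroup N] → [Module A N] → Prop :=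
  DefClosure A (fun N _ _ => ∃ (Q : Type u) (_ : AddCommGroup Q) (_ : Module A Q),
    𝒬 Q ∧ Nonempty (N ≃ₗ[A] CharacterModule Q))

/-- A module `M` is countably presented if it admits a presentation with countably many
generators and countably many relations. -/
def CountablyPresented (A : Type u) [CommRing A] (M : Type u) [AddCommGroup M]
    [Module A M] : Prop :=
  ∃ (g : (ℕ →₀ A) →ₗ[A] M), Function.Surjective g ∧
    ∃ s : Set (ℕ →₀ A), s.Countable ∧ Submodule.span A s = LinearMap.ker g

/-- A module `M` is f-projective if it is flat and Mittag-Leffler relative to `{A}`. -/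
def IsFProjective (A : Type u) [CommRing A] (M : Type u) [AddCommGroup M] [Module A M] : Prop :=
  Module.Flat A M ∧
    IsRelMittagLeffler A M (fun N _ _ => Nonempty (N ≃ₗ[A] A))

/-- `M` is an FP₂ module: there is an exact sequence `F₂ → F₁ → F₀ → M → 0` with the `Fᵢ`
finitely generated free (equivalently, `M` has a projective resolution whose first three
terms are finitely generated). -/
def IsFP2 (A : Type u) [CommRing A] (M : Type u) [AddCommGroup M] [Module A M] : Prop :=
  ∃ (n₀ n₁ n₂ : ℕ) (f₀ : (Fin n₀ → A) →ₗ[A] M) (f₁ : (Fin n₁ → A) →ₗ[A] (Fin n₀ → A))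
    (f₂ : (Fin n₂ → A) →ₗ[A] (Fin n₁ → A)),
    Function.Surjective f₀ ∧ LinearMap.range f₁ = LinearMap.ker f₀ ∧
      LinearMap.range f₂ = LinearMap.ker f₁

/-- `M` has flat (weak) dimension at most `n`: there is a flat resolution
`0 → F_n → ⋯ → F_0 → M → 0` (formalized as a resolution `F` with `F k = 0` for `k > n`). -/
def FlatDimLE (A : Type u) [CommRing A] (M : Type u) [AddCommGroup M] [Module A M]
    (n : ℕ) : Prop :=
  ∃ (F : ℕ → Type u) (_ : ∀ k, AddCommGroup (F k)) (_ : ∀ k, Module A (F k))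
    (d : ∀ k, F (k + 1) →ₗ[A] F k) (ε : F 0 →ₗ[A] M),
    (∀ k, Module.Flat A (F k)) ∧ (∀ k, n < k → Subsingleton (F k)) ∧
    Function.Surjective ε ∧ LinearMap.ker ε = LinearMap.range (d 0) ∧
    ∀ k, LinearMap.ker (d k) = LinearMap.range (d (k + 1))

/-- `M` has injective dimension at most `n`: there is an injective coresolution
`0 → M → I_0 → ⋯ → I_n → 0` (formalized as a coresolution `I` with `I k = 0` for `k > n`). -/
def InjDimLE (A : Type u) [CommRing A] (M : Type u) [AddCommGroup M] [Module A M]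
    (n : ℕ) : Prop :=
  ∃ (I : ℕ → Type u) (_ : ∀ k, AddCommGroup (I k)) (_ : ∀ k, Module A (I k))
    (d : ∀ k, I k →ₗ[A] I (k + 1)) (ε : M →ₗ[A] I 0),
    (∀ k, Module.Injective A (I k)) ∧ (∀ k, n < k → Subsingleton (I k)) ∧
    Function.Injective ε ∧ LinearMap.range ε = LinearMap.ker (d 0) ∧
    ∀ k, LinearMap.range (d k) = LinearMap.ker (d (k + 1))

/-- `B` is pure-injective: every pure monomorphism `X → Y` induces a surjection
`Hom(Y, B) → Hom(X, B)`. -/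
def IsPureInjective (A : Type u) [CommRing A] (B : Type u) [AddCommGroup B]
    [Module A B] : Prop :=
  ∀ (X Y : Type u) [AddCommGroup X] [Module A X] [AddCommGroup Y] [Module A Y]
    (f : X →ₗ[A] Y), IsPureMono f → ∀ g : X →ₗ[A] B, ∃ h : Y →ₗ[A] B, h ∘ₗ f = g

/-- The isomorphism `M ⊗[R] P ≃ (S ⊗[R] M) ⊗[S] P` for an `S`-module `P`. -/
def tensorEquivBaseChangeTensor (R S M P : Type*) [CommRing R] [CommRing S] [Algebra R S]
    [AddCommGroup M] [Module R M] [AddCommGroup P] [Module R P] [Module S P]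
    [IsScalarTower R S P] : M ⊗[R] P ≃ₗ[R] (S ⊗[R] M) ⊗[S] P :=
  TensorProduct.comm R M P ≪≫ₗ
    ((TensorProduct.AlgebraTensorModule.cancelBaseChange R S S P M).symm ≪≫ₗ
      TensorProduct.comm S P (S ⊗[R] M)).restrictScalars R

/-- For a flat `R`-module `M` and a faithfully flat `R`-algebra `S`, the canonical map
`M ⊗[R] ∏ᵢ Nᵢ → ∏ᵢ (M ⊗[R] Nᵢ)` is injective if it is so after base change of `M` and of
each `Nᵢ` to `S`. -/
lemma piRightHom_injective_of_baseChange (R S M : Type*) [CommRing R] [CommRing S]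
    [Algebra R S] [Module.FaithfullyFlat R S] [AddCommGroup M] [Module R M] [Module.Flat R M]
    {I : Type*} (N : I → Type*) [∀ i, AddCommGroup (N i)] [∀ i, Module R (N i)]
    (h : Function.Injective
      (TensorProduct.piRightHom S S (S ⊗[R] M) (fun i => S ⊗[R] N i))) :
    Function.Injective (TensorProduct.piRightHom R R M N) := by
  let j : (∀ i, N i) →ₗ[R] (∀ i, S ⊗[R] N i) :=
    LinearMap.piMap fun i => TensorProduct.mk R S (N i) 1
  have hj : Function.Injective j := fun x y hxy => funext fun i =>
    Module.FaithfullyFlat.tensorProduct_mk_injective (A := R) (B := S) (N i) (congrFun hxy i)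
  let Ψ := tensorEquivBaseChangeTensor R S M (∀ i, S ⊗[R] N i)
  let Φ (i : I) : M ⊗[R] N i →ₗ[R] (S ⊗[R] M) ⊗[S] (S ⊗[R] N i) :=
    (tensorEquivBaseChangeTensor R S M (S ⊗[R] N i)).toLinearMap ∘ₗ
      LinearMap.lTensor M (TensorProduct.mk R S (N i) 1)
  have comm (x : M ⊗[R] (∀ i, N i)) (i : I) :
      TensorProduct.piRightHom S S (S ⊗[R] M) (fun i => S ⊗[R] N i)
        (Ψ (LinearMap.lTensor M j x)) i = Φ i (TensorProduct.piRightHom R R M N x i) := by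
    induction x with
    | zero => simp
    | add x y hx hy => simp only [map_add, Pi.add_apply, hx, hy]
    | tmul m n => rfl
  intro x y hxy
  apply Module.Flat.lTensor_preserves_injective_linearMap (M := M) j hj
  apply Ψ.injective
  apply h
  funext i
  rw [comm, comm, hxy]

/-- Let `φ : R → S` be a faithfully flat homomorphism of commutative rings.
If `M ⊗[R] S` is an f-projective `S`-module, then `M` is an f-projective `R`-module. -/
theorem stmt_13 (R S : Type u) [CommRing R] [CommRing S] [Algebra R S] [Module.FaithfullyFlat R S]
    (M : Type u) [AddCommGroup M] [Module R M]
    (h : IsFProjective S (S ⊗[R] M)) :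
    IsFProjective R M := by
  obtain ⟨hflat, hML⟩ := h
  have : Module.Flat R M := Module.Flat.of_flat_tensorProduct R M S
  refine ⟨this, fun I N _ _ hN => piRightHom_injective_of_baseChange R S M N ?_⟩
  exact hML I (fun i => S ⊗[R] N i) fun i => (hN i).map fun e =>
    e.baseChange R S _ _ ≪≫ₗ TensorProduct.AlgebraTensorModule.rid R S S

end
end

section
/- Let R be a commutative noetherian ring and n ≥ 0. Then (F_n)^⊺ = ^⊥(I_n ∩ PI); that is, for an R-module M, one has Tor_1^R(N, M) = 0 for every R-module N of flat (weak) dimension at most n if and only if Ext_R^1(M, B) = 0 for every pure-injective R-module B of injective dimension at most n. -/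
open TensorProduct CategoryTheory

universe u

noncomputable section

namespace CharacterModule

variable {R A B C : Type*} [CommRing R] [AddCommGroup A] [Module R A] [AddCommGroup B] [Module R B]
  [AddCommGroup C] [Module R C]

/-- A character killing the kernel of a linear map factors through that map. -/
lemma exists_dual_eq_of_ker_le (g : B →ₗ[R] C) (c : CharacterModule B)
    (h : ∀ b, g b = 0 → c b = 0) : ∃ c', dual g c' = c := by
  let K := LinearMap.ker g
  let c₀ : CharacterModule (B ⧸ K) :=
    QuotientAddGroup.lift K.toAddSubgroup c fun b hb => h b hb
  obtain ⟨c', hc'⟩ := dual_surjective_of_injective (K.liftQ g le_rfl)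
    (LinearMap.ker_eq_bot.mp (Submodule.ker_liftQ_eq_bot _ _ _ le_rfl)) c₀
  exact ⟨c', CharacterModule.ext _ fun b => DFunLike.congr_fun hc' (Submodule.Quotient.mk b)⟩

/-- The character module functor preserves and reflects exactness. -/
theorem exact_dual_iff {f : A →ₗ[R] B} {g : B →ₗ[R] C} :
    Function.Exact (dual g) (dual f) ↔ Function.Exact f g := by
  refine ⟨fun h b => ⟨fun hb => ?_, ?_⟩, fun h c => ⟨fun hc => ?_, ?_⟩⟩
  · rw [← LinearMap.coe_range, SetLike.mem_coe, ← Submodule.Quotient.mk_eq_zero]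
    refine eq_zero_of_character_apply fun c => ?_
    obtain ⟨c', hc'⟩ := (h (dual (LinearMap.range f).mkQ c)).mp <| CharacterModule.ext _ fun a => by
      change c ((LinearMap.range f).mkQ (f a)) = 0
      rw [show (LinearMap.range f).mkQ (f a) = 0 by simp, map_zero]
    exact (DFunLike.congr_fun hc' b).symm.trans ((congrArg c' hb).trans (map_zero c'))
  · rintro ⟨a, rfl⟩
    refine eq_zero_of_character_apply fun c => ?_
    exact DFunLike.congr_fun ((h (dual g c)).mpr ⟨c, rfl⟩) a
  · refine exists_dual_eq_of_ker_le g c fun b hb => ?_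
    obtain ⟨a, rfl⟩ := (h b).mp hb
    exact DFunLike.congr_fun hc a
  · rintro ⟨c', rfl⟩
    refine CharacterModule.ext _ fun a => ?_
    exact (congrArg c' (h.apply_apply_eq_zero a)).trans (map_zero c')

lemma ker_dual_eq_range {f : A →ₗ[R] B} {g : B →ₗ[R] C}
    (h : LinearMap.ker g = LinearMap.range f) :
    LinearMap.ker (dual f) = LinearMap.range (dual g) :=
  LinearMap.exact_iff.mp (exact_dual_iff.mpr (LinearMap.exact_iff.mpr h))

lemma subsingleton (A : Type*) [AddCommGroup A] [Subsingleton A] :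
    Subsingleton (CharacterModule A) :=
  ⟨fun c c' => CharacterModule.ext _ fun a => by
    rw [Subsingleton.elim a 0, map_zero, map_zero]⟩

lemma sum_apply {ι : Type*} (s : Finset ι) (c : ι → CharacterModule A) (a : A) :
    (∑ i ∈ s, c i) a = ∑ i ∈ s, c i a :=
  AddMonoidHom.finsetSum_apply (M := A) (N := AddCircle (1 : ℚ)) c s a

/-- Exactness of a tensored complex, tested by homomorphisms into the character module. -/
theorem rTensor_exact_iff_lcomp_exact {f : A →ₗ[R] B} {g : B →ₗ[R] C}
    (N : Type*) [AddCommGroup N] [Module R N] :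
    Function.Exact (f.rTensor N) (g.rTensor N) ↔
      Function.Exact (g.lcomp R (CharacterModule N)) (f.lcomp R (CharacterModule N)) := by
  rw [← exact_dual_iff]
  refine (Function.Exact.iff_of_ladder_linearEquiv (e₁ := homEquiv (R := R))
    (e₂ := homEquiv (R := R)) (e₃ := homEquiv (R := R)) ?_ ?_)
  all_goals
    rw [← dual_rTensor_conj_homEquiv]
    ext x : 1
    simp
    rfl

/-- The evaluation map from a module to its double character module. -/
def toDoubleDual : A →ₗ[R] CharacterModule (CharacterModule A) where
  toFun a :=
    { toFun := fun c => c a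
      map_zero' := rfl
      map_add' := fun _ _ => rfl }
  map_add' a b := CharacterModule.ext _ fun c => map_add c a b
  map_smul' _ _ := rfl

end CharacterModule

section CharacterModule

variable {R : Type u} [CommRing R]

open CharacterModule in
lemma isPureMono_toDoubleDual (B : Type u) [AddCommGroup B] [Module R B] :
    IsPureMono (CharacterModule.toDoubleDual (R := R) (A := B)) := by
  intro P _ _
  rw [rTensor_injective_iff_lcomp_surjective]
  intro φ
  refine ⟨curry (dual (TensorProduct.comm R _ _).toLinearMap
    (uncurry (CharacterModule.toDoubleDual ∘ₗ curry (dual (TensorProduct.comm R _ _).toLinearMap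
      (uncurry φ))))), ?_⟩
  ext b p
  rfl

lemma isPureInjective_characterModule (N : Type u) [AddCommGroup N] [Module R N] :
    IsPureInjective R (CharacterModule N) := by
  intro X Y _ _ _ _ f hf g
  exact rTensor_injective_iff_lcomp_surjective.mp (hf N) g

/-- A pure-injective module is a retract of its double character module. -/
lemma IsPureInjective.exists_comp_toDoubleDual_eq_id {B : Type u} [AddCommGroup B] [Module R B]
    (hB : IsPureInjective R B) :
    ∃ r : CharacterModule (CharacterModule B) →ₗ[R] B, r ∘ₗ CharacterModule.toDoubleDual = .id :=
  hB _ _ _ (isPureMono_toDoubleDual B) .id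

/-- Over a noetherian ring, the character module of an injective module is flat. -/
theorem Module.Flat.characterModule_of_injective [IsNoetherianRing R] (I : Type u)
    [AddCommGroup I] [Module R I] [Module.Injective R I] :
    Module.Flat R (CharacterModule I) := by
  refine Module.Flat.iff_forall_isTrivialRelation.mpr fun {l f x} hx => ?_
  let φ : (Fin l → R) →ₗ[R] R := Fintype.linearCombination R f
  obtain ⟨k, a, ha⟩ := Submodule.fg_iff_exists_fin_generating_family.mp
    (IsNoetherian.noetherian (LinearMap.ker φ))
  let G : (Fin l → I) →ₗ[R] (Fin k → I) :=
    LinearMap.pi fun j => ∑ i, a j i • LinearMap.proj i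
  let c : CharacterModule (Fin l → I) := ∑ i, (x i).comp (Pi.evalAddMonoidHom _ i)
  have hc (w) : c w = ∑ i, x i (w i) :=
    CharacterModule.sum_apply _ _ _
  obtain ⟨c', hc'⟩ := CharacterModule.exists_dual_eq_of_ker_le G c fun w hw => by
    let ψ : (Fin l → R) →ₗ[R] I := Fintype.linearCombination R w
    have hψ : LinearMap.ker φ ≤ LinearMap.ker ψ := by
      rw [← ha, Submodule.span_le]
      rintro _ ⟨j, rfl⟩
      simpa [G, ψ, Fintype.linearCombination_apply] using congrFun hw j
    obtain ⟨θ, hθ⟩ := Module.Injective.out ((LinearMap.ker φ).liftQ φ le_rfl)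
      (LinearMap.ker_eq_bot.mp (Submodule.ker_liftQ_eq_bot _ _ _ le_rfl))
      ((LinearMap.ker φ).liftQ ψ hψ)
    have hw' (i) : w i = f i • θ 1 := by
      have := hθ (Submodule.Quotient.mk (Pi.single i 1))
      simp [φ, ψ] at this
      rw [← this, ← map_smul, smul_eq_mul, mul_one]
    have := DFunLike.congr_fun hx (θ 1)
    rw [hc]
    simp only [hw']
    exact (CharacterModule.sum_apply _ _ _).symm.trans this
  refine ⟨k, fun i j => a j i,
    fun j => CharacterModule.dual (LinearMap.single R (fun _ => I) j) c', ?_, ?_⟩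
  · intro i
    refine CharacterModule.ext _ fun v => ?_
    have h1 : x i v = c (Pi.single i v) := by
      rw [hc, Finset.sum_eq_single i (fun b _ hb => by rw [Pi.single_eq_of_ne hb, map_zero])
        (by simp), Pi.single_eq_same]
    have h2 : G (Pi.single i v) = ∑ j, Pi.single j (a j i • v) := by
      ext j
      simp [G, Finset.sum_apply, Pi.single_apply]
    rw [h1, ← hc']
    change c' (G (Pi.single i v)) = _
    rw [h2, map_sum, CharacterModule.sum_apply]
    rfl
  · intro j
    have : a j ∈ LinearMap.ker φ := ha ▸ Submodule.subset_span ⟨j, rfl⟩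
    simpa [φ, Fintype.linearCombination_apply, mul_comm] using this

end CharacterModule

section Dimension

variable {R : Type u} [CommRing R]

lemma FlatDimLE.injDimLE_characterModule {N : Type u} [AddCommGroup N] [Module R N] {n : ℕ}
    (h : FlatDimLE R N n) : InjDimLE R (CharacterModule N) n := by
  obtain ⟨F, _, _, d, ε, hF, hn, hε, h0, hd⟩ := h
  refine ⟨fun k => CharacterModule (F k), inferInstance, inferInstance,
    fun k => CharacterModule.dual (d k), CharacterModule.dual ε,
    fun k => Module.Flat.iff_characterModule_injective.mp (hF k),
    fun k hk => ?_, CharacterModule.dual_injective_of_surjective _ hε,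
    (CharacterModule.ker_dual_eq_range h0).symm,
    fun k => (CharacterModule.ker_dual_eq_range (hd k)).symm⟩
  have := hn k hk
  exact CharacterModule.subsingleton (F k)

lemma InjDimLE.flatDimLE_characterModule [IsNoetherianRing R]
    {B : Type u} [AddCommGroup B] [Module R B] {n : ℕ}
    (h : InjDimLE R B n) : FlatDimLE R (CharacterModule B) n := by
  obtain ⟨I, _, _, d, ε, hI, hn, hε, h0, hd⟩ := h
  refine ⟨fun k => CharacterModule (I k), inferInstance, inferInstance,
    fun k => CharacterModule.dual (d k), CharacterModule.dual ε,
    fun k => Module.Flat.characterModule_of_injective (I k),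
    fun k hk => ?_, CharacterModule.dual_surjective_of_injective _ hε,
    CharacterModule.ker_dual_eq_range h0.symm,
    fun k => CharacterModule.ker_dual_eq_range (hd k).symm⟩
  have := hn k hk
  exact CharacterModule.subsingleton (I k)

end Dimension

section Derived

variable {R : Type u} [CommRing R] {M : Type u} [AddCommGroup M] [Module R M]
  (P : ProjectiveResolution (ModuleCat.of R M))

lemma tor1Vanishes_iff (N : Type u) [AddCommGroup N] [Module R N] :
    Tor1Vanishes R N M ↔
      Function.Exact ((P.complex.d 2 1).hom.lTensor N) ((P.complex.d 1 0).hom.lTensor N) := by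
  rw [Tor1Vanishes, ← ModuleCat.isZero_iff_subsingleton, Tor_obj,
    (P.isoLeftDerivedObj ((MonoidalCategory.tensoringLeft _).obj (ModuleCat.of R N)) 1).isZero_iff]
  erw [← HomologicalComplex.exactAt_iff_isZero_homology]
  rw [HomologicalComplex.exactAt_iff' _ 2 1 0 (by simp) (by simp),
    ShortComplex.moduleCat_exact_iff_range_eq_ker, eq_comm, LinearMap.exact_iff]
  rfl

lemma ext1Vanishes_iff (B : Type u) [AddCommGroup B] [Module R B] :
    Ext1Vanishes R M B ↔
      Function.Exact ((P.complex.d 1 0).hom.lcomp R B) ((P.complex.d 2 1).hom.lcomp R B) := by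
  rw [Ext1Vanishes, ← ModuleCat.isZero_iff_subsingleton, (P.isoExt 1 _).isZero_iff,
    ← HomologicalComplex.exactAt_iff_isZero_homology,
    HomologicalComplex.exactAt_iff' _ 0 1 2 (by simp) (by simp),
    ShortComplex.moduleCat_exact_iff_range_eq_ker, eq_comm]
  have mem_iff (φ : P.complex.X 1 ⟶ ModuleCat.of R B) :
      φ.hom ∈ LinearMap.ker ((P.complex.d 2 1).hom.lcomp R B) ↔ P.complex.d 2 1 ≫ φ = 0 := by
    rw [ModuleCat.hom_ext_iff]; rfl
  have mem_range_iff (φ : P.complex.X 1 ⟶ ModuleCat.of R B) :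
      φ.hom ∈ LinearMap.range ((P.complex.d 1 0).hom.lcomp R B) ↔
        ∃ ψ, P.complex.d 1 0 ≫ ψ = φ :=
    ⟨fun ⟨ψ, h⟩ => ⟨ModuleCat.ofHom ψ, ModuleCat.hom_ext h⟩,
      fun ⟨ψ, h⟩ => ⟨ψ.hom, congrArg ModuleCat.Hom.hom h⟩⟩
  rw [LinearMap.exact_iff, SetLike.ext_iff, SetLike.ext_iff]
  exact ⟨fun h φ => (mem_iff (ModuleCat.ofHom φ)).trans
      ((h (ModuleCat.ofHom φ)).trans (mem_range_iff (ModuleCat.ofHom φ)).symm),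
    fun h φ => (mem_iff φ).symm.trans ((h φ.hom).trans (mem_range_iff φ))⟩

variable (M) in
/-- Duality between `Tor` and `Ext` through character modules. -/
theorem ext1Vanishes_characterModule_iff (N : Type u) [AddCommGroup N] [Module R N] :
    Ext1Vanishes R M (CharacterModule N) ↔ Tor1Vanishes R N M := by
  let P := projectiveResolution (ModuleCat.of R M)
  rw [ext1Vanishes_iff P, tor1Vanishes_iff P, ← CharacterModule.rTensor_exact_iff_lcomp_exact,
    LinearMap.rTensor_exact_iff_lTensor_exact]

lemma Ext1Vanishes.of_retract {B C : Type u} [AddCommGroup B] [Module R B] [AddCommGroup C]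
    [Module R C] (i : B →ₗ[R] C) (r : C →ₗ[R] B) (h : r ∘ₗ i = .id) (hC : Ext1Vanishes R M C) :
    Ext1Vanishes R M B := by
  let P := projectiveResolution (ModuleCat.of R M)
  rw [ext1Vanishes_iff P] at hC ⊢
  intro φ
  refine ⟨fun hφ => ?_, ?_⟩
  · obtain ⟨ψ, hψ⟩ := (hC (i ∘ₗ φ)).mp (congrArg (i ∘ₗ ·) hφ |>.trans (LinearMap.comp_zero i))
    refine ⟨r ∘ₗ ψ, ?_⟩
    change r ∘ₗ (ψ ∘ₗ _) = φ
    rw [show ψ ∘ₗ _ = i ∘ₗ φ from hψ, ← LinearMap.comp_assoc, h, LinearMap.id_comp]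
  · rintro ⟨ψ, rfl⟩
    rw [LinearMap.lcomp_apply', LinearMap.lcomp_apply', LinearMap.comp_assoc,
      ← ModuleCat.hom_comp, P.complex.d_comp_d, ModuleCat.hom_zero, LinearMap.comp_zero]

end Derived

/-- Let `R` be commutative noetherian and `n ≥ 0`. For an `R`-module `M`:
`Tor₁(N, M) = 0` for every `N` of flat dimension `≤ n` iff `Ext¹(M, B) = 0` for every
pure-injective `B` of injective dimension `≤ n`; in symbols, `(F_n)^⊺ = ^⊥(I_n ∩ PI)`. -/
theorem stmt_16 (R : Type u) [CommRing R] [IsNoetherianRing R] (n : ℕ)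
    (M : Type u) [AddCommGroup M] [Module R M] :
    (∀ (N : Type u) [AddCommGroup N] [Module R N], FlatDimLE R N n → Tor1Vanishes R N M) ↔
      (∀ (B : Type u) [AddCommGroup B] [Module R B],
        IsPureInjective R B → InjDimLE R B n → Ext1Vanishes R M B) := by
  refine ⟨fun h B _ _ hB hn => ?_, fun h N _ _ hN => ?_⟩
  · obtain ⟨r, hr⟩ := hB.exists_comp_toDoubleDual_eq_id
    exact .of_retract CharacterModule.toDoubleDual r hr <|
      (ext1Vanishes_characterModule_iff M _).mpr (h _ hn.flatDimLE_characterModule)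
  · exact (ext1Vanishes_characterModule_iff M N).mp
      (h _ (isPureInjective_characterModule N) hN.injDimLE_characterModule)

end
end
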